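/- Main theorem (O(log² n)-approximation under submodularity over signals): Let n ≥ 3 agents have nonnegative valuation functions v_1,…,v_n : [0,1]^n → ℝ, each monotone non-decreasing in every coordinate and submodular over signals, let s ∈ [0,1]^n, and let OPT = max_i v_i(s). Define the allocation x_i(v,s) = 1/((2·log₂ n + 1)·(ln n + 1)·(|D_i(v,s)| + 1)). Then: (a) the allocation is feasible, i.e., ∑_{i=1}^n x_i(v,s) ≤ 1; and (b) the expected welfare satisfies ∑_{i=1}^n x_i(v,s)·v_i(s) ≥ (1 − 1/log₂ n)^{log₂ n} · OPT / ( 2·(2·log₂ n + 1)·(ln n + 1) ). -/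

import Mathlib

open Function

/-- A signal profile: each of the `n` agents has a signal in `[0,1]`. -/
abbrev Sig (n : ℕ) := Fin n → unitInterval

/-- A valid valuation function: nonnegative and monotone non-decreasing in each coordinate. -/
def ValidVal {n : ℕ} (v : Sig n → ℝ) : Prop :=
  (∀ s, 0 ≤ v s) ∧ Monotone v

/-- `log₂ n` as a real number. -/
noncomputable def lgn (n : ℕ) : ℝ := Real.logb 2 (n : ℝ)

/-- The set `D_i(v,s)` of agents `j ≠ i` with `v_j(1_i, s_{-i}) ≥ v_i(s)` and
`v_j(0_i, s_{-i}) ≥ (1 − 1/log₂ n)·v_i(s)`. -/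
def Dset (n : ℕ) (v : Fin n → Sig n → ℝ) (s : Sig n) (i : Fin n) : Set (Fin n) :=
  {j | j ≠ i ∧ v i s ≤ v j (Function.update s i 1) ∧
    (1 - 1 / lgn n) * v i s ≤ v j (Function.update s i 0)}

/-- The allocation probability `x_i(v,s) = 1/((2·log₂ n + 1)·(ln n + 1)·(|D_i(v,s)| + 1))`. -/
noncomputable def xalloc (n : ℕ) (v : Fin n → Sig n → ℝ) (s : Sig n) (i : Fin n) : ℝ :=
  1 / ((2 * lgn n + 1) * (Real.log (n : ℝ) + 1) * (((Dset n v s i).ncard : ℝ) + 1))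

/-- The threshold `T_ℓ = (1 − 1/log₂ n)^ℓ · OPT`. -/
noncomputable def Tlev (n : ℕ) (OPT : ℝ) (ℓ : ℕ) : ℝ := (1 - 1 / lgn n) ^ ℓ * OPT

/-- `ℓ(i)`: the minimal level `ℓ` such that `v_i(s) ≥ T_ℓ`. -/
noncomputable def lev (n : ℕ) (v : Fin n → Sig n → ℝ) (s : Sig n) (OPT : ℝ) (i : Fin n) : ℕ :=
  sInf {m : ℕ | Tlev n OPT m ≤ v i s}

/-- The set `E_i(v,s)` of agents `j ≠ i` with `v_j(1_i, s_{-i}) ≥ T_{ℓ(i)}` and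
`v_j(0_i, s_{-i}) ≥ T_{ℓ(i)+1}`. -/
def Eset (n : ℕ) (v : Fin n → Sig n → ℝ) (s : Sig n) (OPT : ℝ) (i : Fin n) : Set (Fin n) :=
  {j | j ≠ i ∧ Tlev n OPT (lev n v s OPT i) ≤ v j (Function.update s i 1) ∧
    Tlev n OPT (lev n v s OPT i + 1) ≤ v j (Function.update s i 0)}

/-- `y_i(v,s) = 1/((2·log₂ n + 1)·(ln n + 1)·(|E_i(v,s)| + 1))`. -/
noncomputable def yalloc (n : ℕ) (v : Fin n → Sig n → ℝ) (s : Sig n) (OPT : ℝ) (i : Fin n) : ℝ :=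
  1 / ((2 * lgn n + 1) * (Real.log (n : ℝ) + 1) * (((Eset n v s OPT i).ncard : ℝ) + 1))

/-- `N_0` is the number of agents with `v_j(s) ≥ T_0`; for `k ≥ 1`, `N_k` is the number
of agents with `T_k ≤ v_j(s) < T_{k-1}`. -/
noncomputable def Nlevel (n : ℕ) (v : Fin n → Sig n → ℝ) (s : Sig n) (OPT : ℝ) : ℕ → ℕ
  | 0 => ({j : Fin n | Tlev n OPT 0 ≤ v j s}).ncard
  | (k+1) => ({j : Fin n | Tlev n OPT (k+1) ≤ v j s ∧ v j s < Tlev n OPT k}).ncard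

/-- Submodularity over signals. -/
def SOS {n : ℕ} (v : Sig n → ℝ) : Prop :=
  ∀ (i : Fin n) (s s' : Sig n) (t : unitInterval),
    s ≤ s' → s i = s' i → s i ≤ t →
    v (Function.update s' i t) - v s' ≤ v (Function.update s i t) - v s

lemma aux_zero {n : ℕ} (v : Sig n → ℝ) (hs : SOS v) (s : Sig n) (A : Finset (Fin n)) :
    ∑ i ∈ A, (v s - v (Function.update s i 0)) ≤
      v s - v (fun k => if k ∈ A then 0 else s k) := by
  classical
  induction A using Finset.induction_on with
  | empty => simp
  | insert i A hi ih =>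
    rw [Finset.sum_insert hi]
    have h := hs i (fun k => if k ∈ insert i A then 0 else s k) (Function.update s i 0) (s i)
      (by
        intro k
        by_cases hk : k = i
        · subst hk; simp
        · simp only [Function.update_of_ne hk]
          split_ifs
          · exact unitInterval.nonneg'
          · exact le_rfl)
      (by simp)
      (by simpa using unitInterval.nonneg')
    have e1 : Function.update (Function.update s i 0) i (s i) = s := by simp
    have e2 : Function.update (fun k => if k ∈ insert i A then 0 else s k) i (s i)
        = fun k => if k ∈ A then 0 else s k := by
      funext k
      by_cases hk : k = i
      · subst hk; simp [hi]
      · simp [Function.update_of_ne hk, hk]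
    rw [e1, e2] at h
    linarith

lemma aux_L (n : ℕ) (hn : 3 ≤ n) : 1 < lgn n := by
  unfold lgn
  rw [Real.lt_logb_iff_rpow_lt (by norm_num) (by positivity)]
  have : (3 : ℝ) ≤ n := by exact_mod_cast hn
  norm_num
  linarith

lemma aux_fail (n : ℕ) (hn : 3 ≤ n)
    (v : Fin n → Sig n → ℝ) (hval : ∀ j, ValidVal (v j)) (hsos : ∀ j, SOS (v j))
    (s : Sig n) (j : Fin n) (A : Finset (Fin n))
    (hA : ∀ i ∈ A, v i s ≤ v j s ∧ v j (Function.update s i 0) < (1 - 1 / lgn n) * v i s) :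
    (A.card : ℝ) ≤ lgn n := by
  have hL := aux_L n hn
  have hL0 : 0 < 1 / lgn n := by positivity
  have hb : 0 < 1 - 1 / lgn n := by
    rw [sub_pos, div_lt_one (by linarith)]; exact hL
  rcases A.eq_empty_or_nonempty with rfl | ⟨i0, hi0⟩
  · simp; linarith
  have hpos : 0 < v j s := by
    obtain ⟨h1, h2⟩ := hA i0 hi0
    have h3 := (hval j).1 (Function.update s i0 0)
    have h4 : 0 < v i0 s := by
      by_contra h
      push Not at h
      nlinarith
    linarith
  have h1 := aux_zero (v j) (hsos j) s A
  have h2 := (hval j).1 (fun k => if k ∈ A then 0 else s k)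
  have h3 : ∑ i ∈ A, (v j s / lgn n) ≤ ∑ i ∈ A, (v j s - v j (Function.update s i 0)) := by
    apply Finset.sum_le_sum
    intro i hi
    obtain ⟨h4, h5⟩ := hA i hi
    have h6 : (1 - 1 / lgn n) * v i s ≤ (1 - 1 / lgn n) * v j s :=
      mul_le_mul_of_nonneg_left h4 hb.le
    have : v j s / lgn n = 1 / lgn n * v j s := by ring
    rw [this]
    linarith
  rw [Finset.sum_const, nsmul_eq_mul] at h3
  have h7 : (A.card : ℝ) * (v j s / lgn n) ≤ v j s := by linarith
  rw [← mul_div_assoc, div_le_iff₀ (by linarith), mul_comm] at h7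
  exact le_of_mul_le_mul_left h7 hpos

lemma aux_K (n : ℕ) (hn : 3 ≤ n)
    (v : Fin n → Sig n → ℝ) (hval : ∀ j, ValidVal (v j)) (hsos : ∀ j, SOS (v j))
    (s : Sig n) (m : ℕ) (S : Finset (Fin n))
    (hS : ∀ i ∈ S, (Dset n v s i).ncard ≤ m) :
    (S.card : ℝ) ≤ (2 * lgn n + 1) * (m + 1) := by
  classical
  have hL := aux_L n hn
  have key : ∀ i ∈ S, ∀ j ∈ S, (if v i s ≤ v j s then (1 : ℝ) else 0) ≤
      (if i = j then 1 else 0) + (if j ∈ Dset n v s i then 1 else 0) +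
      (if v i s ≤ v j s ∧ v j (Function.update s i 0) < (1 - 1 / lgn n) * v i s
        then 1 else 0) := by
    intro i _ j _
    by_cases h1 : v i s ≤ v j s
    · by_cases h2 : i = j
      · have : (0 : ℝ) ≤ (if j ∈ Dset n v s i then 1 else 0) := by split_ifs <;> norm_num
        have : (0 : ℝ) ≤ (if v i s ≤ v j s ∧
          v j (Function.update s i 0) < (1 - 1 / lgn n) * v i s then 1 else 0) := by
          split_ifs <;> norm_num
        rw [if_pos h1, if_pos h2]
        linarith
      · by_cases h3 : v j (Function.update s i 0) < (1 - 1 / lgn n) * v i s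
        · have h4 : v i s ≤ v j s ∧ v j (Function.update s i 0) < (1 - 1 / lgn n) * v i s := ⟨h1, h3⟩
          rw [if_pos h1, if_neg h2, if_pos h4]
          split_ifs <;> norm_num
        · have : j ∈ Dset n v s i := by
            refine ⟨fun h => h2 h.symm, h1.trans ((hval j).2 ?_), not_lt.mp h3⟩
            rw [le_update_iff]
            exact ⟨unitInterval.le_one', fun _ _ => le_rfl⟩
          rw [if_pos h1, if_pos this, if_neg h2, if_neg (fun h => h3 h.2)]
          norm_num
    · rw [if_neg h1]
      have : ¬ (v i s ≤ v j s ∧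
          v j (Function.update s i 0) < (1 - 1 / lgn n) * v i s) := fun h => h1 h.1
      rw [if_neg this]
      split_ifs <;> norm_num
  have hP := Finset.sum_le_sum fun i hi => Finset.sum_le_sum (key i hi)
  simp only [Finset.sum_add_distrib] at hP
  have hdiag : ∑ i ∈ S, ∑ j ∈ S, (if i = j then (1 : ℝ) else 0) = S.card := by
    simp
  have hD : ∑ i ∈ S, ∑ j ∈ S, (if j ∈ Dset n v s i then (1 : ℝ) else 0) ≤ S.card * m := by
    rw [← nsmul_eq_mul]
    apply Finset.sum_le_card_nsmul
    intro i hi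
    rw [Finset.sum_boole]
    have : (S.filter (fun j => j ∈ Dset n v s i)).card ≤ (Dset n v s i).ncard := by
      rw [← Set.ncard_coe_finset]
      apply Set.ncard_le_ncard _ (Set.toFinite _)
      intro j hj
      simp at hj
      exact hj.2
    exact_mod_cast this.trans (hS i hi)
  have hF : ∑ i ∈ S, ∑ j ∈ S, (if v i s ≤ v j s ∧
      v j (Function.update s i 0) < (1 - 1 / lgn n) * v i s then (1 : ℝ) else 0)
      ≤ S.card * lgn n := by
    rw [Finset.sum_comm, ← nsmul_eq_mul]
    apply Finset.sum_le_card_nsmul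
    intro j hj
    rw [Finset.sum_boole]
    apply aux_fail n hn v hval hsos s j
    intro i hi
    exact (Finset.mem_filter.mp hi).2
  have hT : ∑ i ∈ S, ∑ j ∈ S, (1 + (if i = j then (1 : ℝ) else 0)) ≤
      ∑ i ∈ S, ∑ j ∈ S, ((if v i s ≤ v j s then (1 : ℝ) else 0) +
        (if v j s ≤ v i s then (1 : ℝ) else 0)) := by
    apply Finset.sum_le_sum; intro i _
    apply Finset.sum_le_sum; intro j _
    by_cases h : i = j
    · subst h; simp
    · rcases le_total (v i s) (v j s) with h1 | h1
      · simp only [h, h1, if_true, if_false]; split_ifs <;> norm_num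
      · simp only [h, h1, if_true, if_false]; split_ifs <;> norm_num
  simp only [Finset.sum_add_distrib] at hT
  rw [hdiag] at hT hP
  rw [Finset.sum_comm (f := fun i j => if v j s ≤ v i s then (1 : ℝ) else 0)] at hT
  simp only [Finset.sum_const, nsmul_eq_mul, mul_one] at hT
  rcases Nat.eq_zero_or_pos S.card with h0 | h0
  · rw [h0]; push_cast; positivity
  have h0' : (0 : ℝ) < S.card := by exact_mod_cast h0
  have hfin : (S.card : ℝ) * (S.card + 1) ≤ S.card * (2 * (1 + m + lgn n)) := by
    nlinarith
  have := le_of_mul_le_mul_left hfin h0'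
  have hm : (0 : ℝ) ≤ m := by positivity
  nlinarith

lemma aux_abel {ι : Type*} [Fintype ι] (d : ι → ℕ) (C : ℝ)
    (h : ∀ m : ℕ, ((Finset.univ.filter fun i => d i ≤ m).card : ℝ) ≤ C * (m + 1)) (N : ℕ) :
    ∑ i ∈ Finset.univ.filter (fun i => d i ≤ N), 1 / ((d i : ℝ) + 1) ≤
      C * (harmonic (N + 1) : ℝ) - C +
        ((Finset.univ.filter fun i => d i ≤ N).card : ℝ) / (N + 1) := by
  classical
  induction N with
  | zero =>
    have : ∑ i ∈ Finset.univ.filter (fun i => d i ≤ 0), 1 / ((d i : ℝ) + 1)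
        = ((Finset.univ.filter fun i => d i ≤ 0).card : ℝ) := by
      rw [Finset.card_eq_sum_ones]
      push_cast
      apply Finset.sum_congr rfl
      intro i hi
      have : d i = 0 := by simpa using hi
      simp [this]
    rw [this]
    simp [harmonic]
  | succ N ih =>
    have hsplit : Finset.univ.filter (fun i => d i ≤ N + 1) =
        Finset.univ.filter (fun i => d i ≤ N) ∪ Finset.univ.filter (fun i => d i = N + 1) := by
      ext i; simp; omega
    have hdis : Disjoint (Finset.univ.filter (fun i => d i ≤ N))
        (Finset.univ.filter (fun i => d i = N + 1)) := by
      rw [Finset.disjoint_left]; intro i; simp; omega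
    rw [hsplit, Finset.sum_union hdis, Finset.card_union_of_disjoint hdis]
    have e : ∑ i ∈ Finset.univ.filter (fun i => d i = N + 1), 1 / ((d i : ℝ) + 1) =
        ((Finset.univ.filter (fun i => d i = N + 1)).card : ℝ) / (N + 2) := by
      rw [Finset.sum_congr rfl (g := fun _ => 1 / ((N : ℝ) + 2)), Finset.sum_const, nsmul_eq_mul]
      · ring
      · intro i hi
        have : d i = N + 1 := by simpa using hi
        rw [this]; push_cast; ring
    rw [e, harmonic_succ (N + 1)]
    have hN := h N
    generalize ((Finset.univ.filter (fun i => d i ≤ N)).card) = K at *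
    generalize ((Finset.univ.filter (fun i => d i = N + 1)).card) = K' at *
    push_cast
    have e2 : (N : ℝ) + 1 + 1 = N + 2 := by ring
    rw [e2]
    have hk : (K : ℝ) / (N + 1) ≤ K / (N + 2) + C * ((N : ℝ) + 2)⁻¹ := by
      rw [← div_eq_mul_inv, ← add_div, div_le_div_iff₀ (by positivity) (by positivity)]
      nlinarith
    rw [add_div, mul_add]
    linarith

lemma aux_feas (n : ℕ) (hn : 3 ≤ n)
    (v : Fin n → Sig n → ℝ) (hval : ∀ j, ValidVal (v j)) (hsos : ∀ j, SOS (v j))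
    (s : Sig n) :
    ∑ i : Fin n, 1 / (((Dset n v s i).ncard : ℝ) + 1) ≤
      (2 * lgn n + 1) * (Real.log n + 1) := by
  have hL := aux_L n hn
  obtain ⟨N, rfl⟩ : ∃ N, n = N + 1 := ⟨n - 1, by omega⟩
  have hK := fun m => aux_K (N + 1) hn v hval hsos s m
    (Finset.univ.filter fun i => (Dset (N + 1) v s i).ncard ≤ m) (by simp)
  have h := aux_abel (fun i => (Dset (N + 1) v s i).ncard) (2 * lgn (N + 1) + 1) hK N
  have hall : Finset.univ.filter (fun i => (Dset (N + 1) v s i).ncard ≤ N) = Finset.univ := by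
    ext i
    simp only [Finset.mem_filter, Finset.mem_univ, true_and, iff_true]
    have : (Dset (N + 1) v s i).ncard < (Set.univ : Set (Fin (N + 1))).ncard := by
      apply Set.ncard_lt_ncard _ (Set.toFinite _)
      rw [Set.ssubset_univ_iff]
      intro h
      have : i ∈ Dset (N + 1) v s i := by rw [h]; trivial
      exact this.1 rfl
    rw [Set.ncard_univ, Nat.card_fin] at this
    omega
  have hKN := hK N
  rw [hall] at h hKN
  have h1 : ((Finset.univ : Finset (Fin (N + 1))).card : ℝ) / (N + 1) ≤ 2 * lgn (N + 1) + 1 := by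
    rw [div_le_iff₀ (by positivity)]; exact hKN
  have h2 := harmonic_le_one_add_log (N + 1)
  have h3 : (2 * lgn (N + 1) + 1) * (harmonic (N + 1) : ℝ) ≤
      (2 * lgn (N + 1) + 1) * (Real.log ((N + 1 : ℕ) : ℝ) + 1) :=
    mul_le_mul_of_nonneg_left (by linarith) (by linarith)
  linarith

lemma aux_welf (n : ℕ) (hn : 3 ≤ n)
    (v : Fin n → Sig n → ℝ) (hval : ∀ j, ValidVal (v j))
    (s : Sig n) (OPT : ℝ) (hOPT : IsGreatest (Set.range fun i => v i s) OPT) :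
    (1 - 1 / lgn n) ^ (lgn n) * OPT / 2 ≤
      ∑ i : Fin n, v i s / (((Dset n v s i).ncard : ℝ) + 1) := by
  classical
  have hL := aux_L n hn
  obtain ⟨⟨i0, hi0⟩, -⟩ := hOPT
  have hi0 : v i0 s = OPT := hi0
  have hO : 0 ≤ OPT := hi0 ▸ (hval i0).1 s
  set β := 1 - 1 / lgn n with hβ
  have hb : 0 < β := by
    rw [hβ, sub_pos, div_lt_one (by linarith)]; exact hL
  have hb1 : β ≤ 1 := by
    have : 0 < 1 / lgn n := by positivity
    linarith
  let M : ℕ → Finset (Fin n) := fun k => Finset.univ.filter fun j => β ^ k * OPT ≤ v j s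
  obtain ⟨k, hk, hM⟩ : ∃ k : ℕ, (k : ℝ) ≤ lgn n ∧ (M (k + 1)).card ≤ 2 * (M k).card := by
    by_contra hcon
    push Not at hcon
    have hgrow : ∀ k : ℕ, k ≤ ⌊lgn n⌋₊ + 1 → 2 ^ k ≤ (M k).card := by
      intro k
      induction k with
      | zero =>
        intro _
        have : i0 ∈ M 0 := by simp [M, hi0]
        simpa using Finset.card_pos.mpr ⟨i0, this⟩
      | succ k ih =>
        intro hk
        have h1 := ih (by omega)
        have h2 := hcon k ((Nat.le_floor_iff (by linarith)).mp (by omega))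
        rw [pow_succ]; omega
    have h1 := hgrow _ le_rfl
    have h2 : (M (⌊lgn n⌋₊ + 1)).card ≤ n := by
      simpa using Finset.card_le_univ (M (⌊lgn n⌋₊ + 1))
    have h3 : (2 : ℝ) ^ (⌊lgn n⌋₊ + 1) ≤ n := by exact_mod_cast h1.trans h2
    have h4 : lgn n < (⌊lgn n⌋₊ + 1 : ℕ) := by
      push_cast; exact Nat.lt_floor_add_one _
    unfold lgn at h4
    rw [Real.logb_lt_iff_lt_rpow (by norm_num) (by positivity), Real.rpow_natCast] at h4
    exact absurd h3 (not_le.mpr h4)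
  have hpow : β ^ (lgn n) ≤ β ^ k := by
    rw [← Real.rpow_natCast]
    exact Real.rpow_le_rpow_of_exponent_ge hb hb1 hk
  have hMpos : 0 < (M k).card := by
    refine Finset.card_pos.mpr ⟨i0, ?_⟩
    simp only [M, Finset.mem_filter, Finset.mem_univ, true_and, hi0]
    exact mul_le_of_le_one_left hO (pow_le_one₀ hb.le hb1)
  have hMpos' : (0 : ℝ) < (M k).card := by exact_mod_cast hMpos
  have hD : ∀ i ∈ M k, (Dset n v s i).ncard + 1 ≤ 2 * (M k).card := by
    intro i hi
    refine le_trans ?_ hM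
    have hi' : β ^ k * OPT ≤ v i s := by simpa [M] using hi
    have hvi := (hval i).1 s
    have hsub : insert i (Dset n v s i) ⊆ (M (k + 1) : Set (Fin n)) := by
      have hstep : β ^ (k + 1) * OPT ≤ β * v i s := by
        rw [pow_succ']; nlinarith
      intro j hj
      simp only [M, Finset.coe_filter, Finset.mem_univ, true_and, Set.mem_ofPred_eq]
      rcases hj with rfl | hj
      · nlinarith
      · refine hstep.trans (hj.2.2.trans ((hval j).2 ?_))
        rw [update_le_iff]
        exact ⟨unitInterval.nonneg', fun _ _ => le_rfl⟩
    have h := Set.ncard_le_ncard hsub (Set.toFinite _)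
    rw [Set.ncard_insert_of_notMem (fun h => h.1 rfl) (Set.toFinite _),
      Set.ncard_coe_finset] at h
    exact h
  have hterm : ∀ i ∈ M k, β ^ k * OPT / (2 * (M k).card) ≤
      v i s / (((Dset n v s i).ncard : ℝ) + 1) := by
    intro i hi
    have hi' : β ^ k * OPT ≤ v i s := by simpa [M] using hi
    have : ((Dset n v s i).ncard : ℝ) + 1 ≤ 2 * (M k).card := by exact_mod_cast hD i hi
    exact div_le_div₀ ((hval i).1 s) hi' (by positivity) this
  calc β ^ (lgn n) * OPT / 2 ≤ β ^ k * OPT / 2 := by gcongr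
    _ = ∑ i ∈ M k, β ^ k * OPT / (2 * (M k).card) := by
        rw [Finset.sum_const, nsmul_eq_mul]; field_simp
    _ ≤ ∑ i ∈ M k, v i s / (((Dset n v s i).ncard : ℝ) + 1) := Finset.sum_le_sum hterm
    _ ≤ _ := by
        apply Finset.sum_le_sum_of_subset_of_nonneg (Finset.subset_univ _)
        intro i _ _
        exact div_nonneg ((hval i).1 s) (by positivity)

/-- main theorem (an `O(log² n)`-approximation under submodularity over
signals).  For `n ≥ 3` agents with nonnegative, monotone, SOS valuations, the allocation
`x_i(v,s) = 1/((2·log₂ n + 1)·(ln n + 1)·(|D_i(v,s)| + 1))` is (a) feasible and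
(b) guarantees welfare at least
`(1 − 1/log₂ n)^{log₂ n} · OPT / (2·(2·log₂ n + 1)·(ln n + 1))`,
where the exponent `log₂ n` is a real power. -/
theorem stmt14 (n : ℕ) (hn : 3 ≤ n)
    (v : Fin n → Sig n → ℝ) (hval : ∀ j, ValidVal (v j)) (hsos : ∀ j, SOS (v j))
    (s : Sig n)
    (OPT : ℝ) (hOPT : IsGreatest (Set.range fun i => v i s) OPT) :
    (∑ i : Fin n, xalloc n v s i ≤ 1) ∧
    ((1 - 1 / lgn n) ^ (lgn n) * OPT / (2 * (2 * lgn n + 1) * (Real.log (n : ℝ) + 1)) ≤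
      ∑ i : Fin n, xalloc n v s i * v i s) := by
  have hL := aux_L n hn
  have hlog : 0 ≤ Real.log (n : ℝ) := Real.log_natCast_nonneg n
  have hC : 0 < (2 * lgn n + 1) * (Real.log (n : ℝ) + 1) := by positivity
  have hx : ∀ i, xalloc n v s i = (1 / (((Dset n v s i).ncard : ℝ) + 1)) /
      ((2 * lgn n + 1) * (Real.log (n : ℝ) + 1)) := by
    intro i
    unfold xalloc
    rw [div_div, mul_comm (((Dset n v s i).ncard : ℝ) + 1)]
  constructor
  · simp only [hx]
    rw [← Finset.sum_div, div_le_one hC]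
    exact aux_feas n hn v hval hsos s
  · have h := aux_welf n hn v hval s OPT hOPT
    have e : ∑ i : Fin n, xalloc n v s i * v i s =
        (∑ i : Fin n, v i s / (((Dset n v s i).ncard : ℝ) + 1)) /
          ((2 * lgn n + 1) * (Real.log (n : ℝ) + 1)) := by
      rw [Finset.sum_div]
      apply Finset.sum_congr rfl
      intro i _
      rw [hx]; ring
    rw [e, mul_assoc 2, ← div_div]
    gcongr
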